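/- For a > 0, the limit as x → 0⁺ of [∫_x^∞ a/((e^t - 1)(e^{at} - 1)) dt - 1/x - ((1+a)/2)·ln x] exists and equals S(a) - (ln(2π) - γ)/2, where S(a) = Σ_{n=1}^∞ [ln(n/a) - a/(2n) - ψ(n/a)]. -/

import Mathlib

open Real Filter MeasureTheory

/-- The digamma function `ψ(x) = Γ'(x)/Γ(x) = d(log Γ)/dx`. -/
noncomputable def digamma (x : ℝ) : ℝ := deriv (fun y : ℝ => Real.log (Real.Gamma y)) x

/-- `S(a) = Σ_{n=1}^∞ [ln(n/a) - a/(2n) - ψ(n/a)]`. -/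
noncomputable def S (a : ℝ) : ℝ :=
  ∑' n : ℕ+, (Real.log ((n : ℝ) / a) - a / (2 * (n : ℝ)) - digamma ((n : ℝ) / a))

/-- The kernel of Binet's integral for the digamma function. -/
noncomputable def binetKernel (t : ℝ) : ℝ := 1 / (exp t - 1) - 1 / t + 1 / 2

lemma exp_sub_one_pos {t : ℝ} (ht : 0 < t) : 0 < exp t - 1 := by
  linarith [add_one_lt_exp ht.ne']

lemma continuousOn_binetKernel : ContinuousOn binetKernel (Set.Ioi 0) := by
  unfold binetKernel
  have h₁ : ∀ t ∈ Set.Ioi (0 : ℝ), exp t - 1 ≠ 0 := fun t ht => (exp_sub_one_pos ht).ne'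
  have h₂ : ∀ t ∈ Set.Ioi (0 : ℝ), t ≠ 0 := fun t ht => ne_of_gt ht
  fun_prop (disch := assumption)

lemma binetKernel_nonneg {t : ℝ} (ht : 0 < t) : 0 ≤ binetKernel t := by
  have hmono : MonotoneOn (fun s : ℝ => exp s * (s - 2) + s + 2) (Set.Ici 0) := by
    refine monotoneOn_of_hasDerivWithinAt_nonneg (f' := fun s => exp s * (s - 1) + 1)
      (convex_Ici 0) (by fun_prop) (fun s _ => ?_) (fun s _ => ?_)
    · have h := (((hasDerivAt_exp s).mul ((hasDerivAt_id s).sub_const 2)).add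
        (hasDerivAt_id s)).add_const 2
      refine (h.congr_deriv ?_).hasDerivWithinAt
      simp only [id]
      ring
    · have h := add_one_le_exp (-s)
      have h' : exp s * exp (-s) = 1 := by rw [← exp_add]; simp
      nlinarith [exp_pos s]
  have h := hmono (Set.mem_Ici.2 le_rfl) (Set.mem_Ici.2 ht.le) ht.le
  norm_num at h
  have he := exp_sub_one_pos ht
  have hid : binetKernel t = (exp t * (t - 2) + t + 2) / (2 * t * (exp t - 1)) := by
    unfold binetKernel
    field_simp
    ring
  rw [hid]
  exact div_nonneg h (by positivity)

lemma binetKernel_le {t : ℝ} (ht : 0 < t) : binetKernel t ≤ t / 4 := by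
  have h := quadratic_le_exp_of_nonneg ht.le
  have h₁ : 1 / (exp t - 1) ≤ 1 / (t + t ^ 2 / 2) :=
    one_div_le_one_div_of_le (by positivity) (by linarith)
  have h₂ : t / 4 - (1 / (t + t ^ 2 / 2) - 1 / t + 1 / 2) = t ^ 2 / (4 * (t + 2)) := by
    field_simp
    ring
  have h₃ : 0 ≤ t ^ 2 / (4 * (t + 2)) := by positivity
  unfold binetKernel
  linarith

lemma integrableOn_mul_exp_neg_mul {z : ℝ} (hz : 0 < z) :
    IntegrableOn (fun t : ℝ => t * exp (-(z * t))) (Set.Ioi 0) := by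
  refine (integrableOn_rpow_mul_exp_neg_mul_rpow (p := 1) (s := 1) (b := z) (by norm_num)
    one_pos hz).congr_fun (fun t _ => ?_) measurableSet_Ioi
  simp

lemma integral_mul_exp_neg_mul {z : ℝ} (hz : 0 < z) :
    ∫ t in Set.Ioi (0 : ℝ), t * exp (-(z * t)) = 1 / z ^ 2 := by
  have h := integral_rpow_mul_exp_neg_mul_Ioi (a := 2) two_pos hz
  norm_num [Real.Gamma_two] at h
  simpa using h

lemma integrableOn_exp_neg_mul {z : ℝ} (hz : 0 < z) :
    IntegrableOn (fun t : ℝ => exp (-(z * t))) (Set.Ioi 0) := by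
  simpa using integrableOn_exp_mul_Ioi (neg_lt_zero.2 hz) 0

lemma integral_exp_neg_mul {z : ℝ} (hz : 0 < z) :
    ∫ t in Set.Ioi (0 : ℝ), exp (-(z * t)) = 1 / z := by
  simpa using integral_exp_mul_Ioi (neg_lt_zero.2 hz) 0

lemma integrableOn_binetKernel_mul_exp {z : ℝ} (hz : 0 < z) :
    IntegrableOn (fun t : ℝ => binetKernel t * exp (-(z * t))) (Set.Ioi 0) := by
  refine ((integrableOn_mul_exp_neg_mul hz).const_mul (1 / 4)).mono'
    ((continuousOn_binetKernel.mul (by fun_prop)).aestronglyMeasurable measurableSet_Ioi) ?_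
  filter_upwards [ae_restrict_mem measurableSet_Ioi] with t ht
  rw [norm_of_nonneg (mul_nonneg (binetKernel_nonneg ht) (exp_pos _).le)]
  have := mul_le_mul_of_nonneg_right (binetKernel_le ht) (exp_pos (-(z * t))).le
  linarith

lemma integral_binetKernel_mul_exp_nonneg (z : ℝ) :
    0 ≤ ∫ t in Set.Ioi (0 : ℝ), binetKernel t * exp (-(z * t)) :=
  setIntegral_nonneg measurableSet_Ioi
    fun _ ht => mul_nonneg (binetKernel_nonneg ht) (exp_pos _).le

lemma integral_binetKernel_mul_exp_le {z : ℝ} (hz : 0 < z) :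
    ∫ t in Set.Ioi (0 : ℝ), binetKernel t * exp (-(z * t)) ≤ 1 / (4 * z ^ 2) := by
  calc _ ≤ ∫ t in Set.Ioi (0 : ℝ), 1 / 4 * (t * exp (-(z * t))) := by
        refine setIntegral_mono_on (integrableOn_binetKernel_mul_exp hz)
          ((integrableOn_mul_exp_neg_mul hz).const_mul _) measurableSet_Ioi fun t ht => ?_
        have := mul_le_mul_of_nonneg_right (binetKernel_le ht) (exp_pos (-(z * t))).le
        linarith
    _ = 1 / (4 * z ^ 2) := by
        rw [integral_const_mul, integral_mul_exp_neg_mul hz]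
        field_simp

lemma one_sub_exp_neg_div_le_one {t : ℝ} (ht : 0 < t) : (1 - exp (-t)) / t ≤ 1 := by
  rw [div_le_one ht]
  linarith [add_one_le_exp (-t)]

/-- Frullani's integral for the exponential, with the exponents one apart. -/
lemma integrable_and_integral_one_sub_exp_neg_div_mul_exp {z : ℝ} (hz : 0 < z) :
    IntegrableOn (fun t : ℝ => (1 - exp (-t)) / t * exp (-(z * t))) (Set.Ioi 0) ∧
      ∫ t in Set.Ioi (0 : ℝ), (1 - exp (-t)) / t * exp (-(z * t)) = log ((z + 1) / z) := by
  have hfi : IntegrableOn (fun t : ℝ => (1 - exp (-t)) / t * exp (-(z * t))) (Set.Ioi 0) := by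
    have hc : ContinuousOn (fun t : ℝ => (1 - exp (-t)) / t * exp (-(z * t))) (Set.Ioi 0) := by
      have h₂ : ∀ t ∈ Set.Ioi (0 : ℝ), t ≠ 0 := fun t ht => ne_of_gt ht
      fun_prop (disch := assumption)
    refine (integrableOn_exp_neg_mul hz).mono' (hc.aestronglyMeasurable measurableSet_Ioi) ?_
    filter_upwards [ae_restrict_mem measurableSet_Ioi] with t ht
    have ht : 0 < t := ht
    have h₀ : 0 ≤ (1 - exp (-t)) / t :=
      div_nonneg (by linarith [exp_le_one_iff.2 (neg_nonpos.2 ht.le)]) ht.le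
    rw [norm_of_nonneg (mul_nonneg h₀ (exp_pos _).le)]
    exact mul_le_of_le_one_left (exp_pos _).le (one_sub_exp_neg_div_le_one ht)
  refine ⟨hfi, ?_⟩
  have hfun : (fun t : ℝ => (1 - exp (-t)) / t * exp (-(z * t))) =
      fun t => t⁻¹ • (exp (-(z * t)) - exp (-((z + 1) * t))) := by
    funext t
    rw [show -((z + 1) * t) = -t + -(z * t) by ring, exp_add, smul_eq_mul]
    ring
  rw [hfun] at hfi ⊢
  have hL : Tendsto (fun t : ℝ => exp (-t)) (nhdsWithin 0 (Set.Ioi 0)) (nhds 1) := by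
    have : Continuous fun t : ℝ => exp (-t) := by fun_prop
    simpa using (this.tendsto 0).mono_left nhdsWithin_le_nhds
  have hloc : LocallyIntegrable (fun t : ℝ => exp (-t)) :=
    Continuous.locallyIntegrable (by fun_prop)
  have h := Frullani.integral_Ioi_eq (hloc.locallyIntegrableOn _) hz
    (by positivity : 0 < z + 1) hL tendsto_exp_neg_atTop_nhds_zero hfi
  simpa using h

/-- The remainder of `digamma` after two terms of its asymptotic expansion. -/
noncomputable def digammaRemainder (z : ℝ) : ℝ := log z - 1 / (2 * z) - digamma z

lemma differentiableAt_log_Gamma {z : ℝ} (hz : 0 < z) :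
    DifferentiableAt ℝ (fun y : ℝ => log (Gamma y)) z := by
  refine ((differentiableAt_Gamma ?_).log (Gamma_ne_zero ?_)) <;>
    exact fun m => ne_of_gt (by have : (0 : ℝ) ≤ m := m.cast_nonneg; linarith)

lemma log_Gamma_add_one {z : ℝ} (hz : 0 < z) :
    log (Gamma (z + 1)) = log (Gamma z) + log z := by
  rw [Gamma_add_one hz.ne', log_mul hz.ne' (Gamma_pos_of_pos hz).ne', add_comm]

lemma digamma_add_one {z : ℝ} (hz : 0 < z) : digamma (z + 1) = digamma z + 1 / z := by
  unfold digamma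
  rw [← deriv_comp_add_const, one_div, ← deriv_log,
    ← deriv_fun_add (differentiableAt_log_Gamma hz) (differentiableAt_log hz.ne')]
  apply EventuallyEq.deriv_eq
  filter_upwards [eventually_gt_nhds hz] with y hy using log_Gamma_add_one hy

lemma log_le_digamma_add_one {z : ℝ} (hz : 0 < z) : log z ≤ digamma (z + 1) := by
  have hz' : 0 < z + 1 := by linarith
  refine (le_of_eq ?_).trans <| convexOn_log_Gamma.slope_le_deriv (Set.mem_Ioi.2 hz)
    (Set.mem_Ioi.2 hz') (by linarith) (differentiableAt_log_Gamma hz')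
  simp [slope_def_field, log_Gamma_add_one hz]

lemma digamma_le_log {z : ℝ} (hz : 0 < z) : digamma z ≤ log z := by
  have hz' : 0 < z + 1 := by linarith
  refine (convexOn_log_Gamma.deriv_le_slope (Set.mem_Ioi.2 hz)
    (Set.mem_Ioi.2 hz') (by linarith) (differentiableAt_log_Gamma hz)).trans (le_of_eq ?_)
  simp [slope_def_field, log_Gamma_add_one hz]

lemma tendsto_digammaRemainder_atTop : Tendsto digammaRemainder atTop (nhds 0) := by
  have hinv : Tendsto (fun z : ℝ => 1 / (2 * z)) atTop (nhds 0) := by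
    have := (tendsto_inv_atTop_zero (𝕜 := ℝ)).const_mul (1 / 2)
    simp only [mul_zero] at this
    refine this.congr fun z => ?_
    rw [one_div, one_div, mul_inv]
  refine tendsto_of_tendsto_of_tendsto_of_le_of_le' (neg_zero (G := ℝ) ▸ hinv.neg) hinv ?_ ?_
  · filter_upwards [eventually_gt_atTop 0] with z hz
    have := digamma_le_log hz
    unfold digammaRemainder
    linarith
  · filter_upwards [eventually_gt_atTop 0] with z hz
    have h := log_le_digamma_add_one hz
    rw [digamma_add_one hz] at h
    have h' : 1 / z = 1 / (2 * z) + 1 / (2 * z) := by field_simp; norm_num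
    unfold digammaRemainder
    linarith

lemma digammaRemainder_sub_add_one {z : ℝ} (hz : 0 < z) :
    digammaRemainder z - digammaRemainder (z + 1) =
      1 / (z + 1) + (1 / z - 1 / (z + 1)) / 2 - log ((z + 1) / z) := by
  have hz' : z + 1 ≠ 0 := by positivity
  rw [log_div hz' hz.ne']
  unfold digammaRemainder
  rw [digamma_add_one hz]
  field_simp
  ring

lemma integral_binetKernel_sub_add_one {z : ℝ} (hz : 0 < z) :
    (∫ t in Set.Ioi (0 : ℝ), binetKernel t * exp (-(z * t))) -
        ∫ t in Set.Ioi (0 : ℝ), binetKernel t * exp (-((z + 1) * t)) =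
      1 / (z + 1) + (1 / z - 1 / (z + 1)) / 2 - log ((z + 1) / z) := by
  have hz' : 0 < z + 1 := by linarith
  obtain ⟨hi, hI⟩ := integrable_and_integral_one_sub_exp_neg_div_mul_exp hz
  have h₁ := integrableOn_exp_neg_mul hz
  have h₂ := integrableOn_exp_neg_mul hz'
  have h₃ : IntegrableOn (fun t => (exp (-(z * t)) - exp (-((z + 1) * t))) / 2) (Set.Ioi 0) :=
    (h₁.sub h₂).div_const 2
  have h₄ : IntegrableOn (fun t => exp (-((z + 1) * t)) +
      (exp (-(z * t)) - exp (-((z + 1) * t))) / 2) (Set.Ioi 0) := h₂.add h₃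
  rw [← integral_sub (integrableOn_binetKernel_mul_exp hz) (integrableOn_binetKernel_mul_exp hz'),
    ← integral_exp_neg_mul hz, ← integral_exp_neg_mul hz', ← hI,
    ← integral_sub h₁ h₂, ← integral_div, ← integral_add h₂ h₃,
    ← integral_sub h₄ hi]
  refine setIntegral_congr_fun measurableSet_Ioi fun t ht => ?_
  have he := (exp_sub_one_pos ht).ne'
  have ht : t ≠ 0 := ne_of_gt ht
  have hexp : exp (-((z + 1) * t)) = exp (-(z * t)) / exp t := by
    rw [← exp_sub]; ring_nf
  simp only [binetKernel, hexp, exp_neg t]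
  have := (exp_pos t).ne'
  field_simp
  ring

lemma tendsto_integral_binetKernel_atTop :
    Tendsto (fun z => ∫ t in Set.Ioi (0 : ℝ), binetKernel t * exp (-(z * t))) atTop (nhds 0) := by
  have hb : Tendsto (fun z : ℝ => 1 / (4 * z ^ 2)) atTop (nhds 0) :=
    tendsto_const_nhds.div_atTop ((tendsto_pow_atTop two_ne_zero).const_mul_atTop (by norm_num))
  refine tendsto_of_tendsto_of_tendsto_of_le_of_le' tendsto_const_nhds hb
    (Eventually.of_forall integral_binetKernel_mul_exp_nonneg) ?_
  filter_upwards [eventually_gt_atTop 0] with z hz using integral_binetKernel_mul_exp_le hz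

/-- **Binet's integral** for the digamma function. -/
lemma integral_binetKernel_mul_exp {z : ℝ} (hz : 0 < z) :
    ∫ t in Set.Ioi (0 : ℝ), binetKernel t * exp (-(z * t)) = digammaRemainder z := by
  set d : ℝ → ℝ := fun w =>
    (∫ t in Set.Ioi (0 : ℝ), binetKernel t * exp (-(w * t))) - digammaRemainder w with hd
  have hstep (n : ℕ) : d (z + n) = d z := by
    induction n with
    | zero => simp
    | succ n ih =>
      have hzn : 0 < z + n := by positivity
      have h₁ := integral_binetKernel_sub_add_one hzn
      have h₂ := digammaRemainder_sub_add_one hzn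
      rw [← ih, Nat.cast_succ, ← add_assoc]
      simp only [hd]
      linarith
  have hlim : Tendsto d atTop (nhds 0) := by
    simpa using tendsto_integral_binetKernel_atTop.sub tendsto_digammaRemainder_atTop
  have hshift : Tendsto (fun n : ℕ => d (z + n)) atTop (nhds 0) :=
    hlim.comp (tendsto_atTop_add_const_left _ _ tendsto_natCast_atTop_atTop)
  have h := tendsto_nhds_unique hshift (by simp only [hstep]; exact tendsto_const_nhds)
  simp only [hd] at h
  linarith

lemma mul_exp_half_le_exp_sub_one {t : ℝ} (ht : 0 ≤ t) : t * exp (t / 2) ≤ exp t - 1 := by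
  have h := self_le_sinh_iff.2 (show 0 ≤ t / 2 by linarith)
  rw [sinh_eq] at h
  have h₁ : exp t = exp (t / 2) * exp (t / 2) := by rw [← exp_add]; ring_nf
  have h₂ : exp (t / 2) * exp (-(t / 2)) = 1 := by rw [← exp_add]; simp
  nlinarith [exp_pos (t / 2)]

lemma continuousOn_binetKernel_comp_mul {a : ℝ} (ha : 0 < a) :
    ContinuousOn (fun u => binetKernel (a * u)) (Set.Ioi 0) :=
  continuousOn_binetKernel.comp (by fun_prop) fun _ hu => mul_pos ha hu

lemma integrableOn_binetKernel_div {a : ℝ} (ha : 0 < a) :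
    IntegrableOn (fun u => a * binetKernel (a * u) / (exp u - 1)) (Set.Ioi 0) := by
  have hc : ContinuousOn (fun u => a * binetKernel (a * u) / (exp u - 1)) (Set.Ioi 0) :=
    (continuousOn_const.mul (continuousOn_binetKernel_comp_mul ha)).div (by fun_prop)
      fun u hu => (exp_sub_one_pos hu).ne'
  refine ((integrableOn_exp_neg_mul (z := 1 / 2) (by norm_num)).const_mul (a ^ 2 / 4)).mono'
    (hc.aestronglyMeasurable measurableSet_Ioi) ?_
  filter_upwards [ae_restrict_mem measurableSet_Ioi] with u hu
  have hu : 0 < u := hu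
  have he := exp_sub_one_pos hu
  have hau := mul_pos ha hu
  rw [norm_of_nonneg (div_nonneg (mul_nonneg ha.le (binetKernel_nonneg hau)) he.le)]
  calc a * binetKernel (a * u) / (exp u - 1)
      ≤ a * (a * u / 4) / (u * exp (u / 2)) := by
        gcongr
        · exact binetKernel_le hau
        · exact mul_exp_half_le_exp_sub_one hu.le
    _ = a ^ 2 / 4 * exp (-(1 / 2 * u)) := by
        rw [show -(1 / 2 * u) = -(u / 2) by ring, exp_neg]
        field_simp

lemma hasSum_exp_neg_succ_mul {u : ℝ} (hu : 0 < u) :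
    HasSum (fun n : ℕ => exp (-((n + 1 : ℝ) * u))) (1 / (exp u - 1)) := by
  have hlt : exp (-u) < 1 := exp_lt_one_iff.2 (neg_lt_zero.2 hu)
  convert! (hasSum_geometric_of_lt_one (exp_pos (-u)).le hlt).mul_left (exp (-u)) using 1
  · funext n
    rw [← exp_nat_mul, ← exp_add]
    ring_nf
  · have := exp_sub_one_pos hu
    rw [exp_neg]
    have := exp_pos u
    have h : 1 - (exp u)⁻¹ = (exp u - 1) / exp u := by field_simp
    rw [h]
    field_simp

lemma hasSum_digammaRemainder {a : ℝ} (ha : 0 < a) :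
    HasSum (fun n : ℕ => digammaRemainder ((n + 1) / a))
      (∫ u in Set.Ioi (0 : ℝ), a * binetKernel (a * u) / (exp u - 1)) := by
  set F : ℕ → ℝ → ℝ := fun n u => a * (binetKernel (a * u) * exp (-((n + 1 : ℝ) * u)))
  have hg (n : ℕ) (u : ℝ) : exp (-((n + 1 : ℝ) * u)) = exp (-((n + 1 : ℝ) / a * (a * u))) := by
    field_simp
  have hpos (n : ℕ) : 0 < ((n : ℝ) + 1) / a := by positivity
  have hF_int (n : ℕ) : IntegrableOn (F n) (Set.Ioi 0) := by
    simp only [F, hg]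
    refine Integrable.const_mul ?_ a
    rw [← IntegrableOn, integrableOn_Ioi_comp_mul_left_iff
      (fun t => binetKernel t * exp (-((n + 1 : ℝ) / a * t))) 0 ha, mul_zero]
    exact integrableOn_binetKernel_mul_exp (hpos n)
  have hF (n : ℕ) : ∫ u in Set.Ioi (0 : ℝ), F n u = digammaRemainder ((n + 1) / a) := by
    rw [← integral_binetKernel_mul_exp (hpos n)]
    have h := integral_comp_mul_left_Ioi'
      (fun t => binetKernel t * exp (-((n + 1 : ℝ) / a * t))) 0 ha
    rw [mul_zero] at h
    rw [← h]
    simp only [F, hg, integral_const_mul, smul_eq_mul]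
  have hF_norm (n : ℕ) : ∫ u in Set.Ioi (0 : ℝ), ‖F n u‖ = digammaRemainder ((n + 1) / a) := by
    rw [← hF]
    refine setIntegral_congr_fun measurableSet_Ioi fun u hu => norm_of_nonneg ?_
    exact mul_nonneg ha.le (mul_nonneg (binetKernel_nonneg (mul_pos ha hu)) (exp_pos _).le)
  have hsum : Summable fun n : ℕ => digammaRemainder ((n + 1) / a) := by
    have hs : Summable fun n : ℕ => a ^ 2 / 4 * (1 / ((n + 1 : ℕ) : ℝ) ^ 2) :=
      ((summable_nat_add_iff 1).2
        (summable_one_div_nat_pow.2 one_lt_two)).mul_left (a ^ 2 / 4)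
    refine hs.of_nonneg_of_le (fun n => ?_) fun n => ?_
    · rw [← integral_binetKernel_mul_exp (hpos n)]
      exact integral_binetKernel_mul_exp_nonneg _
    · rw [← integral_binetKernel_mul_exp (hpos n)]
      refine (integral_binetKernel_mul_exp_le (hpos n)).trans (le_of_eq ?_)
      push_cast
      field_simp
  have h := hasSum_integral_of_summable_integral_norm hF_int (by simpa only [hF_norm] using hsum)
  simp only [hF] at h
  convert! h using 1
  refine setIntegral_congr_fun measurableSet_Ioi fun u hu => ?_
  have := ((hasSum_exp_neg_succ_mul hu).mul_left (a * binetKernel (a * u))).tsum_eq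
  simp only [F, ← mul_assoc] at this ⊢
  rw [this]
  ring

lemma S_eq_integral {a : ℝ} (ha : 0 < a) :
    S a = ∫ u in Set.Ioi (0 : ℝ), a * binetKernel (a * u) / (exp u - 1) := by
  rw [← (hasSum_digammaRemainder ha).tsum_eq, S,
    tsum_pnat_eq_tsum_succ (f := fun n : ℕ =>
      log ((n : ℝ) / a) - a / (2 * (n : ℝ)) - digamma ((n : ℝ) / a))]
  refine tsum_congr fun n => ?_
  unfold digammaRemainder
  push_cast
  congr 2
  field_simp

lemma digamma_nat_add_one (n : ℕ) : digamma (n + 1) = harmonic n - eulerMascheroniConstant := by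
  have hn : (0 : ℝ) < n + 1 := by positivity
  have hd : DifferentiableAt ℝ Gamma (n + 1) := (hasDerivAt_Gamma_nat n).differentiableAt
  unfold digamma
  rw [deriv.log hd (Gamma_pos_of_pos hn).ne', deriv_Gamma_nat, Gamma_nat_eq_factorial]
  field_simp
  ring

lemma sum_range_harmonic (N : ℕ) :
    ∑ n ∈ Finset.range N, (harmonic n : ℝ) = N * harmonic N - N := by
  induction N with
  | zero => simp
  | succ N ih =>
    rw [Finset.sum_range_succ, ih, harmonic_succ]
    push_cast
    field_simp
    ring

lemma sum_range_digammaRemainder (N : ℕ) :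
    ∑ n ∈ Finset.range N, digammaRemainder (n + 1) =
      log N.factorial - harmonic N / 2 - N * harmonic N + N + N * eulerMascheroniConstant := by
  induction N with
  | zero => simp
  | succ N ih =>
    rw [Finset.sum_range_succ, ih, harmonic_succ, Nat.factorial_succ]
    unfold digammaRemainder
    rw [digamma_nat_add_one]
    push_cast
    rw [log_mul (by positivity) (by positivity)]
    field_simp
    ring

/-- The harmonic numbers to order `1 / n`. -/
lemma tendsto_nat_mul_harmonic_sub_log :
    Tendsto (fun N : ℕ => N * (harmonic N - log N - eulerMascheroniConstant)) atTop
      (nhds (1 / 2)) := by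
  have hb : Tendsto (fun N : ℕ => (N : ℝ) * digammaRemainder N) atTop (nhds 0) := by
    have hi : Tendsto (fun N : ℕ => 1 / 4 * (N : ℝ)⁻¹) atTop (nhds 0) := by
      simpa only [mul_zero] using (tendsto_inv_atTop_nhds_zero_nat (𝕜 := ℝ)).const_mul (1 / 4)
    refine tendsto_of_tendsto_of_tendsto_of_le_of_le' tendsto_const_nhds hi ?_ ?_
    · filter_upwards [eventually_gt_atTop 0] with N hN
      have hN : (0 : ℝ) < N := Nat.cast_pos.2 hN
      rw [← integral_binetKernel_mul_exp hN]
      exact mul_nonneg hN.le (integral_binetKernel_mul_exp_nonneg _)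
    · filter_upwards [eventually_gt_atTop 0] with N hN
      have hN : (0 : ℝ) < N := Nat.cast_pos.2 hN
      rw [← integral_binetKernel_mul_exp hN]
      refine (mul_le_mul_of_nonneg_left (integral_binetKernel_mul_exp_le hN) hN.le).trans
        (le_of_eq ?_)
      field_simp
  have h := hb.const_sub (1 / 2)
  rw [sub_zero] at h
  refine h.congr' ?_
  filter_upwards [eventually_gt_atTop 0] with N hN
  have hN : (0 : ℝ) < N := Nat.cast_pos.2 hN
  have h₁ := digamma_add_one hN
  rw [digamma_nat_add_one] at h₁
  unfold digammaRemainder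
  rw [show digamma N = harmonic N - eulerMascheroniConstant - 1 / N by linarith]
  field_simp
  ring

lemma S_one : S 1 = (log (2 * π) - eulerMascheroniConstant - 1) / 2 := by
  have hsum := hasSum_digammaRemainder one_pos
  rw [← S_eq_integral one_pos] at hsum
  simp only [div_one] at hsum
  refine tendsto_nhds_unique hsum.tendsto_sum_nat ?_
  have hst : Tendsto (fun N : ℕ => log (Stirling.stirlingSeq N)) atTop (nhds (log √π)) :=
    Stirling.tendsto_stirlingSeq_sqrt_pi.log (by positivity)
  have h := ((hst.add_const (log 2 / 2)).sub
    (tendsto_harmonic_sub_log.div_const 2)).sub tendsto_nat_mul_harmonic_sub_log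
  have hval : log √π + log 2 / 2 - eulerMascheroniConstant / 2 - 1 / 2 =
      (log (2 * π) - eulerMascheroniConstant - 1) / 2 := by
    rw [log_sqrt pi_pos.le, log_mul two_ne_zero pi_ne_zero]
    ring
  rw [hval] at h
  refine h.congr' ?_
  filter_upwards [eventually_gt_atTop 0] with N hN
  have hN : (N : ℝ) ≠ 0 := (Nat.cast_pos.2 hN).ne'
  rw [sum_range_digammaRemainder, Stirling.log_stirlingSeq_formula, log_mul two_ne_zero hN,
    log_div hN (exp_ne_zero 1), log_exp]
  ring

lemma hasDerivAt_log_one_sub_exp_neg {t : ℝ} (ht : 0 < t) :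
    HasDerivAt (fun t : ℝ => log (1 - exp (-t))) (1 / (exp t - 1)) t := by
  have hlt : exp (-t) < 1 := exp_lt_one_iff.2 (neg_lt_zero.2 ht)
  have h := ((hasDerivAt_neg t).exp.const_sub 1).log (by linarith : 1 - exp (-t) ≠ 0)
  refine h.congr_deriv ?_
  have he := exp_sub_one_pos ht
  have h' : 1 - exp (-t) = (exp t - 1) / exp t := by
    rw [exp_neg]
    field_simp
  rw [h', exp_neg]
  field_simp

lemma hasDerivAt_one_div_exp_sub_one {t : ℝ} (ht : 0 < t) :
    HasDerivAt (fun t : ℝ => 1 / (exp t - 1)) (-exp t / (exp t - 1) ^ 2) t := by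
  simpa only [one_div] using
    ((hasDerivAt_exp t).sub_const 1).fun_inv (exp_sub_one_pos ht).ne'

lemma tendsto_log_one_sub_exp_neg_atTop :
    Tendsto (fun t : ℝ => log (1 - exp (-t))) atTop (nhds 0) := by
  have h : Tendsto (fun t : ℝ => 1 - exp (-t)) atTop (nhds 1) := by
    simpa using tendsto_exp_neg_atTop_nhds_zero.const_sub 1
  simpa using h.log one_ne_zero

lemma integrable_and_integral_one_div_exp_sub_one {x : ℝ} (hx : 0 < x) :
    IntegrableOn (fun t : ℝ => 1 / (exp t - 1)) (Set.Ioi x) ∧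
      ∫ t in Set.Ioi x, 1 / (exp t - 1) = -log (1 - exp (-x)) := by
  have hd : ∀ t ∈ Set.Ici x, HasDerivAt (fun t : ℝ => log (1 - exp (-t))) (1 / (exp t - 1)) t :=
    fun t ht => hasDerivAt_log_one_sub_exp_neg (hx.trans_le ht)
  have hpos : ∀ t ∈ Set.Ioi x, 0 ≤ 1 / (exp t - 1) :=
    fun t ht => (one_div_pos.2 (exp_sub_one_pos (hx.trans ht))).le
  refine ⟨integrableOn_Ioi_deriv_of_nonneg' hd hpos tendsto_log_one_sub_exp_neg_atTop, ?_⟩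
  rw [integral_Ioi_of_hasDerivAt_of_nonneg' hd hpos tendsto_log_one_sub_exp_neg_atTop, zero_sub]

lemma integrable_and_integral_one_div_exp_sub_one_sq {x : ℝ} (hx : 0 < x) :
    IntegrableOn (fun t : ℝ => 1 / (exp t - 1) ^ 2) (Set.Ioi x) ∧
      ∫ t in Set.Ioi x, 1 / (exp t - 1) ^ 2 = 1 / (exp x - 1) + log (1 - exp (-x)) := by
  have hd : ∀ t ∈ Set.Ici x, HasDerivAt
      (fun t : ℝ => -(1 / (exp t - 1)) - log (1 - exp (-t))) (1 / (exp t - 1) ^ 2) t := by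
    intro t ht
    have ht : 0 < t := hx.trans_le ht
    refine ((hasDerivAt_one_div_exp_sub_one ht).fun_neg.fun_sub
      (hasDerivAt_log_one_sub_exp_neg ht)).congr_deriv ?_
    have he := exp_sub_one_pos ht
    field_simp
    ring
  have hpos : ∀ t ∈ Set.Ioi x, 0 ≤ 1 / (exp t - 1) ^ 2 := fun t _ => by positivity
  have hinv : Tendsto (fun t : ℝ => 1 / (exp t - 1)) atTop (nhds 0) :=
    tendsto_const_nhds.div_atTop (tendsto_atTop_add_const_right _ (-1) tendsto_exp_atTop)
  have hlim : Tendsto (fun t : ℝ => -(1 / (exp t - 1)) - log (1 - exp (-t))) atTop (nhds 0) := by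
    simpa using hinv.neg.sub tendsto_log_one_sub_exp_neg_atTop
  refine ⟨integrableOn_Ioi_deriv_of_nonneg' hd hpos hlim, ?_⟩
  rw [integral_Ioi_of_hasDerivAt_of_nonneg' hd hpos hlim]
  ring

lemma tendsto_log_one_sub_exp_neg_sub_log :
    Tendsto (fun x : ℝ => log (1 - exp (-x)) - log x) (nhdsWithin 0 (Set.Ioi 0)) (nhds 0) := by
  have hd : HasDerivAt (fun x : ℝ => 1 - exp (-x)) 1 0 := by
    simpa using (hasDerivAt_neg (0 : ℝ)).exp.const_sub 1
  have h := (hd.tendsto_slope_zero_right).log one_ne_zero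
  rw [log_one] at h
  refine h.congr' ?_
  filter_upwards [self_mem_nhdsWithin] with x hx
  have hx : 0 < x := hx
  have hlt : exp (-x) < 1 := exp_lt_one_iff.2 (neg_lt_zero.2 hx)
  rw [← log_div (by linarith) hx.ne']
  congr 1
  simp
  ring

lemma tendsto_one_div_exp_sub_one_sub_one_div :
    Tendsto (fun x : ℝ => 1 / (exp x - 1) - 1 / x) (nhdsWithin 0 (Set.Ioi 0))
      (nhds (-(1 / 2))) := by
  have hq : Tendsto (fun x : ℝ => x / 4) (nhdsWithin 0 (Set.Ioi 0)) (nhds 0) := by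
    have : Continuous fun x : ℝ => x / 4 := by fun_prop
    simpa using (this.tendsto 0).mono_left nhdsWithin_le_nhds
  have hk : Tendsto binetKernel (nhdsWithin 0 (Set.Ioi 0)) (nhds 0) :=
    tendsto_of_tendsto_of_tendsto_of_le_of_le' tendsto_const_nhds hq
      (eventually_nhdsWithin_of_forall fun _ hx => binetKernel_nonneg hx)
      (eventually_nhdsWithin_of_forall fun _ hx => binetKernel_le hx)
  have h := hk.sub_const (1 / 2)
  rw [zero_sub] at h
  refine h.congr fun x => ?_
  unfold binetKernel
  ring

lemma tendsto_setIntegral_Ioi_nhdsGT_zero {f : ℝ → ℝ} (hf : IntegrableOn f (Set.Ioi 0)) :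
    Tendsto (fun x => ∫ t in Set.Ioi x, f t) (nhdsWithin 0 (Set.Ioi 0))
      (nhds (∫ t in Set.Ioi 0, f t)) :=
  hf.continuousWithinAt_Ici_primitive_Ioi.mono_left (nhdsWithin_mono 0 Set.Ioi_subset_Ici_self)

lemma integral_div_exp_sub_one_mul_exp_sub_one {a x : ℝ} (ha : 0 < a) (hx : 0 < x) :
    ∫ t in Set.Ioi x, a / ((exp t - 1) * (exp (a * t) - 1)) =
      (∫ t in Set.Ioi x, a * binetKernel (a * t) / (exp t - 1)) -
        (∫ t in Set.Ioi x, 1 * binetKernel (1 * t) / (exp t - 1)) +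
        (1 / (exp x - 1) + log (1 - exp (-x))) + (a - 1) / 2 * log (1 - exp (-x)) := by
  obtain ⟨hi₁, hI₁⟩ := integrable_and_integral_one_div_exp_sub_one hx
  obtain ⟨hi₂, hI₂⟩ := integrable_and_integral_one_div_exp_sub_one_sq hx
  have hsub : Set.Ioi x ⊆ Set.Ioi 0 := Set.Ioi_subset_Ioi hx.le
  have hia := (integrableOn_binetKernel_div ha).mono_set hsub
  have hi1 := (integrableOn_binetKernel_div one_pos).mono_set hsub
  have hi₁' := hi₁.const_mul ((a - 1) / 2)
  have hd : IntegrableOn (fun t => a * binetKernel (a * t) / (exp t - 1) -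
      1 * binetKernel (1 * t) / (exp t - 1)) (Set.Ioi x) := hia.sub hi1
  have hs : IntegrableOn (fun t => a * binetKernel (a * t) / (exp t - 1) -
      1 * binetKernel (1 * t) / (exp t - 1) + 1 / (exp t - 1) ^ 2) (Set.Ioi x) := hd.add hi₂
  rw [← hI₂, show (a - 1) / 2 * log (1 - exp (-x)) =
    -((a - 1) / 2 * -log (1 - exp (-x))) by ring, ← hI₁, ← sub_eq_add_neg,
    ← integral_const_mul, ← integral_sub hia hi1, ← integral_add hd hi₂,
    ← integral_sub hs hi₁']
  refine setIntegral_congr_fun measurableSet_Ioi fun t ht => ?_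
  have ht : 0 < t := hx.trans ht
  have he := exp_sub_one_pos ht
  have hea := exp_sub_one_pos (mul_pos ha ht)
  simp only [binetKernel, one_mul]
  field_simp
  ring

theorem S_limit_representation (a : ℝ) (ha : 0 < a) :
    Tendsto (fun x : ℝ =>
        (∫ t in Set.Ioi x, a / ((Real.exp t - 1) * (Real.exp (a * t) - 1)))
          - 1 / x - (1 + a) / 2 * Real.log x)
      (nhdsWithin 0 (Set.Ioi 0))
      (nhds (S a - (Real.log (2 * π) - Real.eulerMascheroniConstant) / 2)) := by
  have hka := tendsto_setIntegral_Ioi_nhdsGT_zero (integrableOn_binetKernel_div ha)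
  have hk1 := tendsto_setIntegral_Ioi_nhdsGT_zero (integrableOn_binetKernel_div one_pos)
  rw [← S_eq_integral ha] at hka
  rw [← S_eq_integral one_pos, S_one] at hk1
  have h := ((hka.sub hk1).add tendsto_one_div_exp_sub_one_sub_one_div).add
    (tendsto_log_one_sub_exp_neg_sub_log.const_mul ((1 + a) / 2))
  have hval : S a - (log (2 * π) - eulerMascheroniConstant - 1) / 2 + -(1 / 2) +
      (1 + a) / 2 * 0 = S a - (log (2 * π) - eulerMascheroniConstant) / 2 := by ring
  rw [hval] at h
  refine h.congr' ?_
  filter_upwards [self_mem_nhdsWithin] with x hx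
  rw [integral_div_exp_sub_one_mul_exp_sub_one ha hx]
  ring
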